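/- Advanced joint convexity of the classical hockey-stick divergence: let μ₀, μ₁, μ₂ be probability measures on a measurable space, let p ∈ [0,1] and γ ≥ 1, and set γ' = 1 + (1−p)(γ−1) and β = γ'/γ. Then E_{γ'}(p·μ₀ + (1−p)·μ₁ ‖ p·μ₀ + (1−p)·μ₂) ≤ (1−p)(1−β)·E_γ(μ₁‖μ₀) + (1−p)·β·E_γ(μ₁‖μ₂). -/

import Mathlib

open MeasureTheory

/-- The classical hockey-stick divergence
`E_γ(μ‖ν) := sup over measurable sets S of (μ(S) − γ·ν(S))`. -/
noncomputable def classicalHS {Ω : Type*} [MeasurableSpace Ω]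
    (γ : ℝ) (μ ν : Measure Ω) : ℝ :=
  ⨆ S : {S : Set Ω // MeasurableSet S}, ((μ S.1).toReal - γ * (ν S.1).toReal)

theorem bddAbove_range_measure_sub_mul {Ω : Type*} [MeasurableSpace Ω]
    {γ : ℝ} (hγ : 0 ≤ γ) (μ ν : Measure Ω) [IsFiniteMeasure μ] :
    BddAbove (Set.range fun S : {S : Set Ω // MeasurableSet S} =>
      (μ S.1).toReal - γ * (ν S.1).toReal) := by
  refine ⟨(μ Set.univ).toReal, ?_⟩
  rintro _ ⟨S, rfl⟩
  have hμ : (μ S.1).toReal ≤ (μ Set.univ).toReal :=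
    ENNReal.toReal_mono (measure_ne_top μ _) (measure_mono (Set.subset_univ _))
  have hν : 0 ≤ γ * (ν S.1).toReal := mul_nonneg hγ ENNReal.toReal_nonneg
  dsimp only
  linarith

theorem measure_sub_mul_le_classicalHS {Ω : Type*} [MeasurableSpace Ω]
    {γ : ℝ} (hγ : 0 ≤ γ) (μ ν : Measure Ω) [IsFiniteMeasure μ]
    {S : Set Ω} (hS : MeasurableSet S) :
    (μ S).toReal - γ * (ν S).toReal ≤ classicalHS γ μ ν :=
  le_ciSup (bddAbove_range_measure_sub_mul hγ μ ν) ⟨S, hS⟩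

theorem toReal_ofReal_smul_add_ofReal_smul_apply {Ω : Type*} [MeasurableSpace Ω]
    {a b : ℝ} (ha : 0 ≤ a) (hb : 0 ≤ b) (μ ν : Measure Ω)
    [IsFiniteMeasure μ] [IsFiniteMeasure ν] (S : Set Ω) :
    ((ENNReal.ofReal a • μ + ENNReal.ofReal b • ν) S).toReal =
      a * (μ S).toReal + b * (ν S).toReal := by
  rw [Measure.add_apply, Measure.smul_apply, Measure.smul_apply, smul_eq_mul, smul_eq_mul,
    ENNReal.toReal_add (ENNReal.mul_ne_top ENNReal.ofReal_ne_top (measure_ne_top μ S))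
      (ENNReal.mul_ne_top ENNReal.ofReal_ne_top (measure_ne_top ν S)),
    ENNReal.toReal_mul, ENNReal.toReal_mul, ENNReal.toReal_ofReal ha, ENNReal.toReal_ofReal hb]

/-- Advanced joint convexity of the classical hockey-stick divergence. -/
theorem advanced_joint_convexity_classical_hockey_stick
    {Ω : Type*} [MeasurableSpace Ω] (μ₀ μ₁ μ₂ : Measure Ω)
    [IsProbabilityMeasure μ₀] [IsProbabilityMeasure μ₁] [IsProbabilityMeasure μ₂]
    (p γ : ℝ) (hp0 : 0 ≤ p) (hp1 : p ≤ 1) (hγ : 1 ≤ γ)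
    (γ' β : ℝ) (hγ' : γ' = 1 + (1 - p) * (γ - 1)) (hβ : β = γ' / γ) :
    classicalHS γ' (ENNReal.ofReal p • μ₀ + ENNReal.ofReal (1 - p) • μ₁)
                   (ENNReal.ofReal p • μ₀ + ENNReal.ofReal (1 - p) • μ₂)
      ≤ (1 - p) * (1 - β) * classicalHS γ μ₁ μ₀
          + (1 - p) * β * classicalHS γ μ₁ μ₂ := by
  have hγ0 : 0 < γ := by linarith
  have hq : 0 ≤ 1 - p := by linarith
  have hγ'_nonneg : 0 ≤ γ' := by
    rw [hγ']
    nlinarith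
  have hγ'_le : γ' ≤ γ := by
    rw [hγ']
    nlinarith
  have hβ0 : 0 ≤ β := hβ ▸ div_nonneg hγ'_nonneg hγ0.le
  have hβ1 : 0 ≤ 1 - β := by
    rw [hβ, sub_nonneg]
    exact (div_le_one hγ0).2 hγ'_le
  have hβγ : β * γ = γ' := by
    rw [hβ]
    exact div_mul_cancel₀ _ hγ0.ne'
  have : Nonempty {S : Set Ω // MeasurableSet S} := ⟨⟨∅, MeasurableSet.empty⟩⟩
  refine ciSup_le fun ⟨S, hS⟩ => ?_
  dsimp only
  rw [toReal_ofReal_smul_add_ofReal_smul_apply hp0 hq,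
    toReal_ofReal_smul_add_ofReal_smul_apply hp0 hq]
  have h₁ := mul_le_mul_of_nonneg_left (measure_sub_mul_le_classicalHS hγ0.le μ₁ μ₀ hS)
    (mul_nonneg hq hβ1)
  have h₂ := mul_le_mul_of_nonneg_left (measure_sub_mul_le_classicalHS hγ0.le μ₁ μ₂ hS)
    (mul_nonneg hq hβ0)
  refine le_of_eq_of_le ?_ (add_le_add h₁ h₂)
  linear_combination
    ((1 - p) * (μ₂ S).toReal - (1 - p) * (μ₀ S).toReal) * hβγ - (μ₀ S).toReal * hγ'
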